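/- Let P ≥ 2 and 2 ≤ R ≤ P, and suppose C₀ > 0 satisfies ∫₀¹ |h(α;P,R)|⁷ dα ≤ C₀·P^{3+Δ₇}, ∫₀¹ |h(α;P,R)|¹⁰ dα ≤ C₀·P^{6+Δ₁₀} and ∫₀¹ |h(α;P,R)|¹² dα ≤ C₀·P^{8}. Let ε > 0 and suppose C₃ > 0 is such that for every T ≥ 1, with 𝒵 = {n ∈ ℤ : |n| ≤ P⁹ and T < |ψ(n)| ≤ 2T}, Z = card(𝒵), ω_n = sgn(ψ(n)) and K(α) = Σ_{n∈𝒵} ω_n e(−nα), one has ∫₀¹ |h(α;P,R)⁴ K(α)²| dα ≤ C₃·(P³Z + P^{2+ε}Z^{3/2}). Then for every T with 1 ≤ T ≤ P^{3+Δ₇}·log P one has M(T) = Σ_{n∈ℤ, |n|≤P⁹, T<|ψ(n)|≤2T} |ψ(n)|³ ≤ C·P^{13 + Δ₁₀/2 + ε}, where C depends at most on C₀, C₃ and ε. -/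

import Mathlib

open scoped Real
open Filter MeasureTheory

noncomputable section

/-- `e(z) = exp(2πiz)`. -/
def e (z : ℝ) : ℂ := Complex.exp (2 * Real.pi * Complex.I * z)

/-- The set `𝒜(P,R)` of `R`-smooth positive integers not exceeding `P`. -/
def smoothA (P R : ℝ) : Finset ℕ :=
  (Finset.Icc 1 ⌊P⌋₊).filter (fun n => ∀ p ∈ n.primeFactors, (p : ℝ) ≤ R)

/-- The smooth Weyl sum `h(α; P, R)`. -/
def h (P R α : ℝ) : ℂ := ∑ x ∈ smoothA P R, e (α * (x : ℝ) ^ 4)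

/-- `Δ₇ = 0.849408`. -/
def Δ₇ : ℝ := 0.849408

/-- `Δ₁₀ = 0.213431`. -/
def Δ₁₀ : ℝ := 0.213431

/-- The Fourier coefficient `ψ(n) = ∫₀¹ |h(α)|⁷ e(-nα) dα`. -/
def ψ (P R : ℝ) (n : ℤ) : ℂ :=
  ∫ α in (0:ℝ)..1, (‖h P R α‖ : ℂ) ^ 7 * e (-(n : ℝ) * α)

/-- The set `𝒵 = {n ∈ ℤ : |n| ≤ P⁹, T < |ψ(n)| ≤ 2T}`. -/
def Zset (P R T : ℝ) : Finset ℤ :=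
  (Finset.Icc (-⌊P ^ 9⌋) ⌊P ^ 9⌋).filter
    (fun n => T < ‖ψ P R n‖ ∧ ‖ψ P R n‖ ≤ 2 * T)

/-- The exponential sum `K(α) = Σ_{n∈𝒵} ω_n e(-nα)`, where `ω_n = sgn ψ(n)`. -/
def K (P R T : ℝ) (α : ℝ) : ℂ :=
  ∑ n ∈ Zset P R T, (if 0 < (ψ P R n).re then (1 : ℂ) else -1) * e (-(n : ℝ) * α)

lemma e_add (x y : ℝ) : e (x + y) = e x * e y := by
  simp only [e, ← Complex.exp_add]
  congr 1
  push_cast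
  ring

lemma e_intCast (m : ℤ) : e (m : ℝ) = 1 := by
  rw [e, ← Complex.exp_int_mul_two_pi_mul_I m]
  congr 1
  push_cast
  ring

lemma conj_e (x : ℝ) : (starRingEnd ℂ) (e x) = e (-x) := by
  rw [e, e, ← Complex.exp_conj]
  congr 1
  simp [Complex.conj_ofNat]

lemma continuous_e : Continuous e := by
  unfold e
  fun_prop

lemma continuous_h (P R : ℝ) : Continuous (h P R) := by
  unfold h
  exact continuous_finsetSum _ fun x _ => continuous_e.comp (by fun_prop)

lemma continuous_K (P R T : ℝ) : Continuous (K P R T) := by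
  unfold K
  exact continuous_finsetSum _ fun x _ =>
    continuous_const.mul (continuous_e.comp (by fun_prop))

lemma norm_h_one_sub (P R α : ℝ) : ‖h P R (1 - α)‖ = ‖h P R α‖ := by
  have : h P R (1 - α) = (starRingEnd ℂ) (h P R α) := by
    simp only [h, map_sum]
    refine Finset.sum_congr rfl fun x _ => ?_
    have hx : (1 - α) * (x : ℝ) ^ 4 = (((x : ℤ) ^ 4 : ℤ) : ℝ) + -(α * (x : ℝ) ^ 4) := by
      push_cast
      ring
    rw [hx, e_add, e_intCast, one_mul, conj_e]
  rw [this, RCLike.norm_conj]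

lemma conj_ψ (P R : ℝ) (n : ℤ) : (starRingEnd ℂ) (ψ P R n) = ψ P R n := by
  have h₁ : (starRingEnd ℂ) (ψ P R n)
      = ∫ α in (0:ℝ)..1, (starRingEnd ℂ) ((‖h P R α‖ : ℂ) ^ 7 * e (-(n : ℝ) * α)) := by
    rw [ψ, intervalIntegral.integral_of_le zero_le_one, intervalIntegral.integral_of_le zero_le_one,
      ← integral_conj]
  have h₂ := intervalIntegral.integral_comp_sub_left (a := 0) (b := 1)
    (fun α => (‖h P R α‖ : ℂ) ^ 7 * e (-(n : ℝ) * α)) 1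
  rw [sub_self, sub_zero] at h₂
  rw [h₁]
  conv_rhs => rw [ψ, ← h₂]
  refine intervalIntegral.integral_congr fun α _ => ?_
  have hα : -(n : ℝ) * (1 - α) = ((-n : ℤ) : ℝ) + -(-(n : ℝ) * α) := by
    push_cast
    ring
  simp only [map_mul, map_pow, Complex.conj_ofReal, norm_h_one_sub]
  rw [hα, e_add, e_intCast, one_mul, conj_e]

lemma sign_mul_ψ (P R : ℝ) (n : ℤ) :
    (if 0 < (ψ P R n).re then (1 : ℂ) else -1) * ψ P R n = (‖ψ P R n‖ : ℂ) := by
  have hr : (((ψ P R n).re : ℝ) : ℂ) = ψ P R n := Complex.conj_eq_iff_re.mp (conj_ψ P R n)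
  rw [← hr]
  simp only [Complex.ofReal_re, Complex.norm_real, Real.norm_eq_abs]
  split_ifs with hp
  · rw [abs_of_pos hp, one_mul]
  · rw [abs_of_nonpos (not_lt.mp hp)]
    push_cast
    ring

lemma integral_e_intCast_mul (m : ℤ) :
    ∫ α in (0:ℝ)..1, e ((m : ℝ) * α) = if m = 0 then 1 else 0 := by
  split_ifs with hm
  · simp [hm, e]
  · have hc : (2 * Real.pi * Complex.I * m : ℂ) ≠ 0 := by
      simp [Real.pi_ne_zero, hm]
    have : ∀ α : ℝ, e ((m : ℝ) * α) = Complex.exp ((2 * Real.pi * Complex.I * m : ℂ) * α) := by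
      intro α
      rw [e]
      congr 1
      push_cast
      ring
    simp only [this]
    rw [integral_exp_mul_complex hc]
    have h₁ : Complex.exp ((2 * Real.pi * Complex.I * m : ℂ) * (1 : ℝ)) = 1 := by
      rw [← Complex.exp_int_mul_two_pi_mul_I m]
      congr 1
      push_cast
      ring
    rw [h₁]
    simp

/-- Parseval's identity for an exponential sum with coefficients `±1`. -/
lemma integral_norm_K_sq (P R T : ℝ) :
    ∫ α in (0:ℝ)..1, ‖K P R T α‖ ^ 2 = ((Zset P R T).card : ℝ) := by
  set w : ℤ → ℂ := fun n => if 0 < (ψ P R n).re then (1 : ℂ) else -1 with hw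
  have hww : ∀ n, w n * (starRingEnd ℂ) (w n) = 1 := by
    intro n
    simp only [hw]
    split_ifs <;> simp
  have hexp : ∀ α : ℝ, ((‖K P R T α‖ ^ 2 : ℝ) : ℂ) = ∑ n ∈ Zset P R T, ∑ m ∈ Zset P R T,
      w n * (starRingEnd ℂ) (w m) * e (((m - n : ℤ) : ℝ) * α) := by
    intro α
    rw [Complex.ofReal_pow, ← Complex.mul_conj', K, map_sum, Finset.sum_mul_sum]
    refine Finset.sum_congr rfl fun n _ => Finset.sum_congr rfl fun m _ => ?_
    have : ((m - n : ℤ) : ℝ) * α = -(n : ℝ) * α + -(-(m : ℝ) * α) := by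
      push_cast
      ring
    rw [this, e_add, map_mul, conj_e]
    ring
  have hcont : ∀ c : ℂ, ∀ m : ℤ, Continuous fun α : ℝ => c * e ((m : ℝ) * α) := fun c m =>
    continuous_const.mul (continuous_e.comp (by fun_prop))
  have hC : ((∫ α in (0:ℝ)..1, ‖K P R T α‖ ^ 2 : ℝ) : ℂ) = ((Zset P R T).card : ℂ) := by
    rw [← intervalIntegral.integral_ofReal]
    simp only [hexp]
    rw [intervalIntegral.integral_finsetSum fun n _ =>
      (continuous_finsetSum _ fun m _ => hcont _ _).intervalIntegrable _ _]
    rw [Finset.card_eq_sum_ones, Nat.cast_sum]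
    refine Finset.sum_congr rfl fun n hn => ?_
    rw [intervalIntegral.integral_finsetSum fun m _ => (hcont _ _).intervalIntegrable _ _]
    simp only [intervalIntegral.integral_const_mul, integral_e_intCast_mul]
    rw [Finset.sum_eq_single n]
    · simp [hww]
    · intro m _ hmn
      simp [sub_eq_zero, hmn]
    · exact fun h' => absurd hn h'
  exact_mod_cast hC

/-- The Cauchy–Schwarz inequality for continuous functions on `[0,1]`. -/
lemma sq_integral_mul_le {f g : ℝ → ℝ} (hf : Continuous f) (hg : Continuous g) :
    (∫ α in (0:ℝ)..1, f α * g α) ^ 2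
      ≤ (∫ α in (0:ℝ)..1, f α ^ 2) * ∫ α in (0:ℝ)..1, g α ^ 2 := by
  have hq : ∀ t : ℝ, 0 ≤ (∫ α in (0:ℝ)..1, f α ^ 2) * (t * t)
      + (2 * ∫ α in (0:ℝ)..1, f α * g α) * t + ∫ α in (0:ℝ)..1, g α ^ 2 := by
    intro t
    have h₀ : 0 ≤ ∫ α in (0:ℝ)..1, (t * f α + g α) ^ 2 :=
      intervalIntegral.integral_nonneg zero_le_one fun α _ => sq_nonneg _
    have h₁ : ∀ α, (t * f α + g α) ^ 2 = t * t * f α ^ 2 + 2 * t * (f α * g α) + g α ^ 2 :=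
      fun α => by ring
    simp only [h₁] at h₀
    rw [intervalIntegral.integral_add (Continuous.intervalIntegrable (by fun_prop) _ _)
        (Continuous.intervalIntegrable (by fun_prop) _ _),
      intervalIntegral.integral_add (Continuous.intervalIntegrable (by fun_prop) _ _)
        (Continuous.intervalIntegrable (by fun_prop) _ _),
      intervalIntegral.integral_const_mul, intervalIntegral.integral_const_mul] at h₀
    linarith
  have := discrim_le_zero hq
  rw [discrim] at this
  linarith

lemma mul_card_Zset_le (P R T : ℝ) :
    T * (Zset P R T).card ≤ ∫ α in (0:ℝ)..1, ‖h P R α‖ ^ 7 * ‖K P R T α‖ := by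
  have hsum : T * (Zset P R T).card ≤ ∑ n ∈ Zset P R T, ‖ψ P R n‖ := by
    have := Finset.card_nsmul_le_sum (Zset P R T) (fun n => ‖ψ P R n‖) T
      fun n hn => (Finset.mem_filter.mp hn).2.1.le
    rw [nsmul_eq_mul] at this
    linarith
  have hcont : Continuous fun α => ((‖h P R α‖ : ℝ) : ℂ) ^ 7 :=
    (Complex.continuous_ofReal.comp (continuous_h P R).norm).pow 7
  have hint : ((∑ n ∈ Zset P R T, ‖ψ P R n‖ : ℝ) : ℂ)
      = ∫ α in (0:ℝ)..1, (‖h P R α‖ : ℂ) ^ 7 * K P R T α := by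
    simp only [K, Finset.mul_sum]
    have hterm : ∀ (c : ℂ) (n : ℤ),
        Continuous fun α : ℝ => ((‖h P R α‖ : ℝ) : ℂ) ^ 7 * (c * e (-(n : ℝ) * α)) := fun c n =>
      hcont.mul (continuous_const.mul (continuous_e.comp (by fun_prop)))
    rw [intervalIntegral.integral_finsetSum fun n _ => (hterm _ n).intervalIntegrable _ _]
    push_cast
    refine Finset.sum_congr rfl fun n _ => ?_
    rw [← sign_mul_ψ]
    conv_lhs => rw [ψ.eq_def P R n]
    rw [← intervalIntegral.integral_const_mul]
    refine intervalIntegral.integral_congr fun α _ => ?_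
    simp only [← ψ.eq_def P R n]
    ring
  have hnonneg : 0 ≤ ∑ n ∈ Zset P R T, ‖ψ P R n‖ := Finset.sum_nonneg fun _ _ => norm_nonneg _
  calc T * (Zset P R T).card ≤ ∑ n ∈ Zset P R T, ‖ψ P R n‖ := hsum
    _ = ‖((∑ n ∈ Zset P R T, ‖ψ P R n‖ : ℝ) : ℂ)‖ := by
      rw [Complex.norm_real, Real.norm_of_nonneg hnonneg]
    _ ≤ ∫ α in (0:ℝ)..1, ‖(‖h P R α‖ : ℂ) ^ 7 * K P R T α‖ := by
      rw [hint]
      exact intervalIntegral.norm_integral_le_integral_norm zero_le_one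
    _ = ∫ α in (0:ℝ)..1, ‖h P R α‖ ^ 7 * ‖K P R T α‖ := by simp

lemma sum_norm_ψ_cube_le (P R T : ℝ) :
    ∑ n ∈ Zset P R T, ‖ψ P R n‖ ^ 3 ≤ 8 * (T ^ 3 * (Zset P R T).card) := by
  have := Finset.sum_le_card_nsmul (Zset P R T) (fun n => ‖ψ P R n‖ ^ 3) ((2 * T) ^ 3)
    fun n hn => pow_le_pow_left₀ (norm_nonneg _) (Finset.mem_filter.mp hn).2.2 3
  rw [nsmul_eq_mul] at this
  linarith

/-- Bounds for `T²Z²` and `T⁴Z⁴` in terms of the mixed moment of order four and the moments of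
orders ten and twelve. -/
lemma sq_and_pow_four_le (P R T : ℝ) (hT : 0 ≤ T) :
    (T * (Zset P R T).card) ^ 2 ≤ (∫ α in (0:ℝ)..1, ‖(h P R α) ^ 4 * (K P R T α) ^ 2‖)
        * ∫ α in (0:ℝ)..1, ‖h P R α‖ ^ 10 ∧
    (T * (Zset P R T).card) ^ 4 ≤ (∫ α in (0:ℝ)..1, ‖h P R α‖ ^ 12) ^ 2
        * ((∫ α in (0:ℝ)..1, ‖(h P R α) ^ 4 * (K P R T α) ^ 2‖) * (Zset P R T).card) := by
  have hh := (continuous_h P R).norm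
  have hK := (continuous_K P R T).norm
  have h₀ : 0 ≤ T * (Zset P R T).card := by positivity
  have h₁ := pow_le_pow_left₀ h₀ (mul_card_Zset_le P R T) 2
  have hA : ∀ α, (‖h P R α‖ ^ 2 * ‖K P R T α‖) ^ 2 = ‖(h P R α) ^ 4 * (K P R T α) ^ 2‖ := by
    intro α
    rw [norm_mul, norm_pow, norm_pow]
    ring
  have c₁ := sq_integral_mul_le (f := fun α => ‖h P R α‖ ^ 2 * ‖K P R T α‖)
    (g := fun α => ‖h P R α‖ ^ 5) (by fun_prop) (by fun_prop)
  have c₂ := sq_integral_mul_le (f := fun α => ‖h P R α‖ ^ 6)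
    (g := fun α => ‖h P R α‖ * ‖K P R T α‖) (by fun_prop) (by fun_prop)
  have c₃ := sq_integral_mul_le (f := fun α => ‖h P R α‖ ^ 2 * ‖K P R T α‖)
    (g := fun α => ‖K P R T α‖) (by fun_prop) hK
  simp only [hA] at c₁ c₃
  rw [integral_norm_K_sq] at c₃
  simp only [← pow_mul] at c₁ c₂
  have e₁ : ∀ α, ‖h P R α‖ ^ 2 * ‖K P R T α‖ * ‖h P R α‖ ^ 5 = ‖h P R α‖ ^ 7 * ‖K P R T α‖ :=
    fun α => by ring
  have e₂ : ∀ α, ‖h P R α‖ ^ 6 * (‖h P R α‖ * ‖K P R T α‖) = ‖h P R α‖ ^ 7 * ‖K P R T α‖ :=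
    fun α => by ring
  have e₃ : ∀ α, ‖h P R α‖ ^ 2 * ‖K P R T α‖ * ‖K P R T α‖ = (‖h P R α‖ * ‖K P R T α‖) ^ 2 :=
    fun α => by ring
  simp only [e₁] at c₁
  simp only [e₂] at c₂
  simp only [e₃] at c₃
  refine ⟨h₁.trans c₁, ?_⟩
  have h₄ := pow_le_pow_left₀ (sq_nonneg _) (h₁.trans c₂) 2
  rw [← pow_mul, mul_pow _ _ 2] at h₄
  exact h₄.trans (mul_le_mul_of_nonneg_left c₃ (sq_nonneg _))

/-- If `T` is large, the bound for `T²Z²` controls `T³Z`. -/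
lemma cube_mul_le_of_large {P T z ε c : ℝ} (hP : 2 ≤ P) (hε : 0 < ε) (hc : 0 < c) (hT : 1 ≤ T)
    (hz : 0 < z) (hTP : T ≤ P ^ ((3:ℝ) + Δ₇) * Real.log P)
    (hlarge : P ^ (3 + 3 / 2 * Δ₁₀ + ε) ≤ T)
    (hb : (T * z ^ 2) ^ 2 ≤ c * P ^ ((6:ℝ) + Δ₁₀) * (P ^ 3 * z ^ 2 + P ^ ((2:ℝ) + ε) * z ^ 3)) :
    T ^ 3 * z ^ 2 ≤ (50 * c + 4 * c ^ 2) * P ^ (13 + Δ₁₀ / 2 + ε) := by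
  have hP0 : 0 < P := by linarith
  have hP1 : 1 ≤ P := by linarith
  have hT0 : 0 < T := by linarith
  have hY : 0 < P ^ (13 + Δ₁₀ / 2 + ε) := by positivity
  rcases le_total (P ^ ((2:ℝ) + ε) * z ^ 3) (P ^ 3 * z ^ 2) with hcase | hcase
  · have hQ : P ^ ((6:ℝ) + Δ₁₀) * P ^ 3 = P ^ (9 + Δ₁₀) := by
      rw [← Real.rpow_natCast, ← Real.rpow_add hP0]
      congr 1
      push_cast
      ring
    have h₁ : T ^ 2 * z ^ 2 ≤ 2 * c * P ^ (9 + Δ₁₀) := by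
      refine le_of_mul_le_mul_right ?_ (pow_pos hz 2)
      calc T ^ 2 * z ^ 2 * z ^ 2 = (T * z ^ 2) ^ 2 := by ring
        _ ≤ _ := hb
        _ ≤ c * P ^ ((6:ℝ) + Δ₁₀) * (P ^ 3 * z ^ 2 + P ^ 3 * z ^ 2) := by gcongr
        _ = 2 * c * P ^ (9 + Δ₁₀) * z ^ 2 := by rw [← hQ]; ring
    have hlog : Real.log P ≤ 25 * P ^ ((1:ℝ) / 25) := by
      have := Real.log_le_rpow_div hP0.le (show (0:ℝ) < 1 / 25 by norm_num)
      linarith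
    have hexp : P ^ ((3:ℝ) + Δ₇) * P ^ ((1:ℝ) / 25) * P ^ (9 + Δ₁₀)
        ≤ P ^ (13 + Δ₁₀ / 2 + ε) := by
      rw [← Real.rpow_add hP0, ← Real.rpow_add hP0]
      refine Real.rpow_le_rpow_of_exponent_le hP1 ?_
      norm_num [Δ₇, Δ₁₀]
      linarith
    calc T ^ 3 * z ^ 2 = T * (T ^ 2 * z ^ 2) := by ring
      _ ≤ P ^ ((3:ℝ) + Δ₇) * (25 * P ^ ((1:ℝ) / 25)) * (2 * c * P ^ (9 + Δ₁₀)) := by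
        gcongr
        exact hTP.trans (by gcongr)
      _ = 50 * c * (P ^ ((3:ℝ) + Δ₇) * P ^ ((1:ℝ) / 25) * P ^ (9 + Δ₁₀)) := by ring
      _ ≤ 50 * c * P ^ (13 + Δ₁₀ / 2 + ε) := by gcongr
      _ ≤ _ := by nlinarith [mul_pos (pow_pos hc 2) hY]
  · have hQ : P ^ ((6:ℝ) + Δ₁₀) * P ^ ((2:ℝ) + ε) = P ^ (8 + Δ₁₀ + ε) := by
      rw [← Real.rpow_add hP0]
      congr 1
      ring
    have h₁ : T ^ 2 * z ≤ 2 * c * P ^ (8 + Δ₁₀ + ε) := by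
      refine le_of_mul_le_mul_right ?_ (pow_pos hz 3)
      calc T ^ 2 * z * z ^ 3 = (T * z ^ 2) ^ 2 := by ring
        _ ≤ _ := hb
        _ ≤ c * P ^ ((6:ℝ) + Δ₁₀) * (P ^ ((2:ℝ) + ε) * z ^ 3 + P ^ ((2:ℝ) + ε) * z ^ 3) := by
          gcongr
        _ = 2 * c * P ^ (8 + Δ₁₀ + ε) * z ^ 3 := by rw [← hQ]; ring
    have hQ2 : (P ^ (8 + Δ₁₀ + ε)) ^ 2
        = P ^ (13 + Δ₁₀ / 2 + ε) * P ^ (3 + 3 / 2 * Δ₁₀ + ε) := by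
      rw [sq, ← Real.rpow_add hP0, ← Real.rpow_add hP0]
      congr 1
      ring
    have h₂ : T ^ 3 * z ^ 2 ≤ 4 * c ^ 2 * P ^ (13 + Δ₁₀ / 2 + ε) := by
      refine le_of_mul_le_mul_right ?_
        (show 0 < P ^ (3 + 3 / 2 * Δ₁₀ + ε) by positivity)
      calc T ^ 3 * z ^ 2 * P ^ (3 + 3 / 2 * Δ₁₀ + ε) ≤ T ^ 3 * z ^ 2 * T := by gcongr
        _ = (T ^ 2 * z) ^ 2 := by ring
        _ ≤ (2 * c * P ^ (8 + Δ₁₀ + ε)) ^ 2 := by gcongr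
        _ = 4 * c ^ 2 * (P ^ (8 + Δ₁₀ + ε)) ^ 2 := by ring
        _ = _ := by rw [hQ2]; ring
    nlinarith [mul_pos hc hY]

/-- If `T` is small, the bound for `T⁴Z⁴` controls `T³Z`. -/
lemma cube_mul_le_of_small {P T z ε c : ℝ} (hP : 2 ≤ P) (hc : 0 < c) (hT : 1 ≤ T)
    (hz : 0 < z) (hsmall : T ≤ P ^ (3 + 3 / 2 * Δ₁₀ + ε))
    (hb : (T * z ^ 2) ^ 4
      ≤ c * (P ^ (8:ℝ)) ^ 2 * (P ^ 3 * z ^ 2 + P ^ ((2:ℝ) + ε) * z ^ 3) * z ^ 2) :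
    T ^ 3 * z ^ 2 ≤ (1 + 2 * c) * P ^ (13 + Δ₁₀ / 2 + ε) := by
  have hP0 : 0 < P := by linarith
  have hP1 : 1 ≤ P := by linarith
  have hT0 : 0 < T := by linarith
  rcases le_total (P ^ ((2:ℝ) + ε) * z ^ 3) (P ^ 3 * z ^ 2) with hcase | hcase
  · have hQ : (P ^ (8:ℝ)) ^ 2 * P ^ 3 = (P ^ ((19:ℝ) / 2)) ^ 2 := by
      rw [← Real.rpow_natCast P 3, sq, sq, ← Real.rpow_add hP0, ← Real.rpow_add hP0,
        ← Real.rpow_add hP0]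
      congr 1
      norm_num
    have h₁ : T ^ 2 * z ^ 2 ≤ (1 + 2 * c) * P ^ ((19:ℝ) / 2) := by
      refine le_of_sq_le_sq ?_ (by positivity)
      refine le_of_mul_le_mul_right ?_ (pow_pos hz 4)
      calc (T ^ 2 * z ^ 2) ^ 2 * z ^ 4 = (T * z ^ 2) ^ 4 := by ring
        _ ≤ _ := hb
        _ ≤ c * (P ^ (8:ℝ)) ^ 2 * (P ^ 3 * z ^ 2 + P ^ 3 * z ^ 2) * z ^ 2 := by gcongr
        _ = 2 * c * ((P ^ (8:ℝ)) ^ 2 * P ^ 3) * z ^ 4 := by ring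
        _ = 2 * c * (P ^ ((19:ℝ) / 2)) ^ 2 * z ^ 4 := by rw [hQ]
        _ ≤ (1 + 2 * c) ^ 2 * (P ^ ((19:ℝ) / 2)) ^ 2 * z ^ 4 := by
          gcongr
          nlinarith
        _ = _ := by ring
    have hexp : P ^ (3 + 3 / 2 * Δ₁₀ + ε) * P ^ ((19:ℝ) / 2) ≤ P ^ (13 + Δ₁₀ / 2 + ε) := by
      rw [← Real.rpow_add hP0]
      refine Real.rpow_le_rpow_of_exponent_le hP1 ?_
      norm_num [Δ₁₀]
      linarith
    calc T ^ 3 * z ^ 2 = T * (T ^ 2 * z ^ 2) := by ring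
      _ ≤ P ^ (3 + 3 / 2 * Δ₁₀ + ε) * ((1 + 2 * c) * P ^ ((19:ℝ) / 2)) := by gcongr
      _ = (1 + 2 * c) * (P ^ (3 + 3 / 2 * Δ₁₀ + ε) * P ^ ((19:ℝ) / 2)) := by ring
      _ ≤ _ := by gcongr
  · have hQ : (P ^ (8:ℝ)) ^ 2 * P ^ ((2:ℝ) + ε) = P ^ (18 + ε) := by
      rw [sq, ← Real.rpow_add hP0, ← Real.rpow_add hP0]
      congr 1
      ring
    have h₁ : T ^ 4 * z ^ 3 ≤ 2 * c * P ^ (18 + ε) := by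
      refine le_of_mul_le_mul_right ?_ (pow_pos hz 5)
      calc T ^ 4 * z ^ 3 * z ^ 5 = (T * z ^ 2) ^ 4 := by ring
        _ ≤ _ := hb
        _ ≤ c * (P ^ (8:ℝ)) ^ 2 * (P ^ ((2:ℝ) + ε) * z ^ 3 + P ^ ((2:ℝ) + ε) * z ^ 3) * z ^ 2 := by
          gcongr
        _ = 2 * c * P ^ (18 + ε) * z ^ 5 := by rw [← hQ]; ring
    have hQ3 : (P ^ (18 + ε)) ^ 2 * P ^ (3 + 3 / 2 * Δ₁₀ + ε) = (P ^ (13 + Δ₁₀ / 2 + ε)) ^ 3 := by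
      rw [← Real.rpow_mul_natCast hP0.le, ← Real.rpow_mul_natCast hP0.le, ← Real.rpow_add hP0]
      congr 1
      push_cast
      ring
    have hc3 : (2 * c) ^ 2 ≤ (1 + 2 * c) ^ 3 := by nlinarith [pow_pos hc 3, pow_pos hc 2]
    refine le_of_pow_le_pow_left₀ three_ne_zero (by positivity) ?_
    calc (T ^ 3 * z ^ 2) ^ 3 = (T ^ 4 * z ^ 3) ^ 2 * T := by ring
      _ ≤ (2 * c * P ^ (18 + ε)) ^ 2 * P ^ (3 + 3 / 2 * Δ₁₀ + ε) := by gcongr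
      _ = (2 * c) ^ 2 * ((P ^ (18 + ε)) ^ 2 * P ^ (3 + 3 / 2 * Δ₁₀ + ε)) := by ring
      _ = (2 * c) ^ 2 * (P ^ (13 + Δ₁₀ / 2 + ε)) ^ 3 := by rw [hQ3]
      _ ≤ (1 + 2 * c) ^ 3 * (P ^ (13 + Δ₁₀ / 2 + ε)) ^ 3 := by gcongr
      _ = _ := by ring

/-- the dyadic cubic moment bound
`M(T) = Σ_{|n|≤P⁹, T<|ψ(n)|≤2T} |ψ(n)|³ ≪ P^{13 + Δ₁₀/2 + ε}`
for `1 ≤ T ≤ P^{3+Δ₇}·log P`. -/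
theorem dyadic_cubic_moment_bound
    (ε C₀ C₃ : ℝ) (hε : 0 < ε) (hC₀ : 0 < C₀) (hC₃ : 0 < C₃) :
    ∃ C : ℝ, ∀ P R : ℝ, 2 ≤ P → 2 ≤ R → R ≤ P →
      (∫ α in (0:ℝ)..1, ‖h P R α‖ ^ 7) ≤ C₀ * P ^ ((3:ℝ) + Δ₇) →
      (∫ α in (0:ℝ)..1, ‖h P R α‖ ^ 10) ≤ C₀ * P ^ ((6:ℝ) + Δ₁₀) →
      (∫ α in (0:ℝ)..1, ‖h P R α‖ ^ 12) ≤ C₀ * P ^ (8:ℝ) →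
      (∀ T : ℝ, 1 ≤ T →
        (∫ α in (0:ℝ)..1, ‖(h P R α) ^ 4 * (K P R T α) ^ 2‖) ≤
          C₃ * (P ^ 3 * ((Zset P R T).card : ℝ) +
            P ^ ((2:ℝ) + ε) * ((Zset P R T).card : ℝ) ^ ((3:ℝ)/2))) →
      ∀ T : ℝ, 1 ≤ T → T ≤ P ^ ((3:ℝ) + Δ₇) * Real.log P →
        (∑ n ∈ Zset P R T, ‖ψ P R n‖ ^ 3) ≤ C * P ^ (13 + Δ₁₀/2 + ε) := by
  refine ⟨8 * ((50 * (C₃ * C₀) + 4 * (C₃ * C₀) ^ 2) + (1 + 2 * (C₀ ^ 2 * C₃))), ?_⟩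
  intro P R hP _ _ _ h10 h12 hmix T hT hTP
  have hP0 : 0 < P := by linarith
  have hY : 0 < P ^ (13 + Δ₁₀ / 2 + ε) := by positivity
  refine (sum_norm_ψ_cube_le P R T).trans ?_
  rw [mul_assoc 8]
  refine mul_le_mul_of_nonneg_left ?_ (by norm_num)
  obtain ⟨hsq, hfour⟩ := sq_and_pow_four_le P R T (by linarith)
  have hA := hmix T hT
  have hI10 : 0 ≤ ∫ α in (0:ℝ)..1, ‖h P R α‖ ^ 10 :=
    intervalIntegral.integral_nonneg zero_le_one fun _ _ => by positivity
  have hI : 0 ≤ ∫ α in (0:ℝ)..1, ‖(h P R α) ^ 4 * (K P R T α) ^ 2‖ :=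
    intervalIntegral.integral_nonneg zero_le_one fun _ _ => norm_nonneg _
  have hI12 : 0 ≤ ∫ α in (0:ℝ)..1, ‖h P R α‖ ^ 12 :=
    intervalIntegral.integral_nonneg zero_le_one fun _ _ => by positivity
  have hZ0 : (0:ℝ) ≤ (Zset P R T).card := Nat.cast_nonneg _
  generalize ((Zset P R T).card : ℝ) = Z at *
  rcases hZ0.eq_or_lt with rfl | hZ
  · rw [mul_zero]
    positivity
  obtain ⟨z, hz, rfl⟩ : ∃ z : ℝ, 0 < z ∧ Z = z ^ 2 :=
    ⟨√Z, Real.sqrt_pos.mpr hZ, (Real.sq_sqrt hZ0).symm⟩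
  have hz3 : (z ^ 2) ^ ((3:ℝ) / 2) = z ^ 3 := by
    rw [← Real.rpow_natCast, ← Real.rpow_natCast, ← Real.rpow_mul hz.le]
    norm_num
  rw [hz3] at hA
  have hc₁ : 0 < 50 * (C₃ * C₀) + 4 * (C₃ * C₀) ^ 2 := by positivity
  have hc₂ : 0 < 1 + 2 * (C₀ ^ 2 * C₃) := by positivity
  rcases le_total (P ^ (3 + 3 / 2 * Δ₁₀ + ε)) T with hlarge | hsmall
  · refine (cube_mul_le_of_large hP hε (mul_pos hC₃ hC₀) hT hz hTP hlarge ?_).trans ?_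
    · calc (T * z ^ 2) ^ 2 ≤ _ := hsq
        _ ≤ C₃ * (P ^ 3 * z ^ 2 + P ^ ((2:ℝ) + ε) * z ^ 3) * (C₀ * P ^ ((6:ℝ) + Δ₁₀)) := by
          gcongr
        _ = _ := by ring
    · exact mul_le_mul_of_nonneg_right (by linarith) hY.le
  · refine (cube_mul_le_of_small hP (mul_pos (pow_pos hC₀ 2) hC₃) hT hz hsmall ?_).trans ?_
    · calc (T * z ^ 2) ^ 4 ≤ _ := hfour
        _ ≤ (C₀ * P ^ (8:ℝ)) ^ 2
            * (C₃ * (P ^ 3 * z ^ 2 + P ^ ((2:ℝ) + ε) * z ^ 3) * z ^ 2) := by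
          gcongr
        _ = _ := by ring
    · exact mul_le_mul_of_nonneg_right (by linarith) hY.le
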